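/- The multiplication map m: T(V)⁺ ⊗ T(V)⁺ → T(V)_{(2)} is surjective and its kernel equals the image of the map id ⊗ m − m ⊗ id : T(V)⁺ ⊗ T(V) ⊗ T(V)⁺ → T(V)⁺ ⊗ T(V)⁺; that is, the sequence T(V)⁺ ⊗ T(V) ⊗ T(V)⁺ → T(V)⁺ ⊗ T(V)⁺ → T(V)_{(2)} → 0 is exact. -/

import Mathlib

/-!
STATEMENT 1: The multiplication map m : T(V)⁺ ⊗ T(V)⁺ → T(V)_{(2)} is surjective and
its kernel equals the image of id ⊗ m − m ⊗ id : T(V)⁺ ⊗ T(V) ⊗ T(V)⁺ → T(V)⁺ ⊗ T(V)⁺;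
that is, the sequence T(V)⁺ ⊗ T(V) ⊗ T(V)⁺ → T(V)⁺ ⊗ T(V)⁺ → T(V)_{(2)} → 0 is exact.

(The subspaces T(V)⁺ ⊗ T(V)⁺ ⊆ T(V) ⊗ T(V) and T(V)⁺ ⊗ T(V) ⊗ T(V)⁺ ⊆ T(V) ⊗ (T(V) ⊗ T(V))
are realized as the ranges of the canonical (injective, as k is a field) inclusions.)
-/

open TensorProduct

namespace Rigidity

/-- The `n`-th graded component `V^{⊗n}` of the tensor algebra `T(V)`. -/
noncomputable def grade (k V : Type*) [Field k] [AddCommGroup V] [Module k V] (n : ℕ) :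
    Submodule k (TensorAlgebra k V) :=
  LinearMap.range (TensorAlgebra.ι k : V →ₗ[k] TensorAlgebra k V) ^ n

/-- The augmentation ideal `T(V)⁺ = ⊕_{n ≥ 1} V^{⊗n}`. -/
noncomputable def Tplus (k V : Type*) [Field k] [AddCommGroup V] [Module k V] :
    Submodule k (TensorAlgebra k V) :=
  ⨆ n : ℕ, grade k V (n + 1)

/-- `T(V)_{(2)} = ⊕_{n ≥ 2} V^{⊗n}`. -/
noncomputable def Ttwo (k V : Type*) [Field k] [AddCommGroup V] [Module k V] :
    Submodule k (TensorAlgebra k V) :=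
  ⨆ n : ℕ, grade k V (n + 2)

/-- The subspace `T(V)⁺ ⊗ T(V)⁺` of `T(V) ⊗ T(V)`. -/
noncomputable def TpTp (k V : Type*) [Field k] [AddCommGroup V] [Module k V] :
    Submodule k (TensorAlgebra k V ⊗[k] TensorAlgebra k V) :=
  LinearMap.range (TensorProduct.map (Tplus k V).subtype (Tplus k V).subtype)

/-- The subspace `T(V)⁺ ⊗ T(V) ⊗ T(V)⁺` of `T(V) ⊗ (T(V) ⊗ T(V))`. -/
noncomputable def TpTTp (k V : Type*) [Field k] [AddCommGroup V] [Module k V] :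
    Submodule k (TensorAlgebra k V ⊗[k] (TensorAlgebra k V ⊗[k] TensorAlgebra k V)) :=
  LinearMap.range (TensorProduct.map (Tplus k V).subtype
    (TensorProduct.map (LinearMap.id : TensorAlgebra k V →ₗ[k] TensorAlgebra k V)
      (Tplus k V).subtype))

/-- The map `id ⊗ m − m ⊗ id : T(V) ⊗ T(V) ⊗ T(V) → T(V) ⊗ T(V)`. -/
noncomputable def theta (k V : Type*) [Field k] [AddCommGroup V] [Module k V] :
    TensorAlgebra k V ⊗[k] (TensorAlgebra k V ⊗[k] TensorAlgebra k V) →ₗ[k]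
      TensorAlgebra k V ⊗[k] TensorAlgebra k V :=
  LinearMap.lTensor (TensorAlgebra k V) (LinearMap.mul' k (TensorAlgebra k V)) -
    (LinearMap.rTensor (TensorAlgebra k V) (LinearMap.mul' k (TensorAlgebra k V))) ∘ₗ
      (TensorProduct.assoc k (TensorAlgebra k V) (TensorAlgebra k V)
        (TensorAlgebra k V)).symm.toLinearMap

section Auxiliary

variable (k V : Type*) [Field k] [AddCommGroup V] [Module k V]

theorem iSup_grade : ⨆ n : ℕ, grade k V n = ⊤ :=
  (DirectSum.Decomposition.isInternal
    (fun n : ℕ => LinearMap.range (TensorAlgebra.ι k : V →ₗ[k] TensorAlgebra k V) ^ n)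
    ).submodule_iSup_eq_top

theorem Tplus_eq_range_mul_top :
    Tplus k V = LinearMap.range (TensorAlgebra.ι k : V →ₗ[k] TensorAlgebra k V) * ⊤ := by
  rw [← iSup_grade, Submodule.mul_iSup]
  simp only [Tplus, grade, pow_succ']

theorem Tplus_eq_top_mul_range :
    Tplus k V = ⊤ * LinearMap.range (TensorAlgebra.ι k : V →ₗ[k] TensorAlgebra k V) := by
  rw [← iSup_grade, Submodule.iSup_mul]
  simp only [Tplus, grade, pow_succ]

variable {k V}

theorem mul_mem_Tplus_right {a : TensorAlgebra k V} (ha : a ∈ Tplus k V)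
    (b : TensorAlgebra k V) : a * b ∈ Tplus k V := by
  have h := Submodule.mul_mem_mul ha (Submodule.mem_top (R := k) (x := b))
  rw [Tplus_eq_range_mul_top, mul_assoc] at h
  rw [Tplus_eq_range_mul_top]
  exact SetLike.le_def.1 (mul_le_mul' le_rfl le_top) h

theorem mul_mem_Tplus_left (a : TensorAlgebra k V) {b : TensorAlgebra k V}
    (hb : b ∈ Tplus k V) : a * b ∈ Tplus k V := by
  have h := Submodule.mul_mem_mul (Submodule.mem_top (R := k) (x := a)) hb
  rw [Tplus_eq_top_mul_range, ← mul_assoc] at h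
  rw [Tplus_eq_top_mul_range]
  exact SetLike.le_def.1 (mul_le_mul' le_top le_rfl) h

theorem ι_mem_Tplus (v : V) : TensorAlgebra.ι k v ∈ Tplus k V := by
  rw [Tplus_eq_range_mul_top, ← mul_one (TensorAlgebra.ι k v)]
  exact Submodule.mul_mem_mul (LinearMap.mem_range_self _ v) Submodule.mem_top

theorem tmul_mem_TpTp {a b : TensorAlgebra k V} (ha : a ∈ Tplus k V) (hb : b ∈ Tplus k V) :
    a ⊗ₜ[k] b ∈ TpTp k V :=
  ⟨⟨a, ha⟩ ⊗ₜ ⟨b, hb⟩, rfl⟩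

theorem tmul_mem_TpTTp {a b : TensorAlgebra k V} (ha : a ∈ Tplus k V) (t : TensorAlgebra k V)
    (hb : b ∈ Tplus k V) : a ⊗ₜ[k] (t ⊗ₜ[k] b) ∈ TpTTp k V :=
  ⟨⟨a, ha⟩ ⊗ₜ (t ⊗ₜ ⟨b, hb⟩), rfl⟩

theorem theta_tmul (a t b : TensorAlgebra k V) :
    theta k V (a ⊗ₜ (t ⊗ₜ b)) = a ⊗ₜ (t * b) - (a * t) ⊗ₜ b := by
  simp [theta]

theorem Tplus_mul_Tplus : Tplus k V * Tplus k V = Ttwo k V := by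
  nth_rw 1 [Tplus_eq_range_mul_top]
  have h : ⊤ * Tplus k V = Tplus k V := by
    refine le_antisymm (Submodule.mul_le.2 fun a _ b hb => mul_mem_Tplus_left a hb) fun b hb => ?_
    rw [← one_mul b]
    exact Submodule.mul_mem_mul Submodule.mem_top hb
  rw [mul_assoc, h, Tplus, Submodule.mul_iSup]
  simp only [Ttwo, grade, ← pow_succ']

theorem map_mul'_TpTp :
    Submodule.map (LinearMap.mul' k (TensorAlgebra k V)) (TpTp k V) = Ttwo k V := by
  rw [← Tplus_mul_Tplus]
  refine le_antisymm ?_ (Submodule.mul_le.2 fun a ha b hb => ⟨a ⊗ₜ b, tmul_mem_TpTp ha hb, rfl⟩)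
  rintro _ ⟨_, ⟨y, rfl⟩, rfl⟩
  induction y using TensorProduct.induction_on with
  | zero => simp
  | tmul a b => exact Submodule.mul_mem_mul a.2 b.2
  | add x y hx hy => simpa only [map_add] using Submodule.add_mem _ hx hy

theorem map_theta_TpTTp_le :
    Submodule.map (theta k V) (TpTTp k V) ≤
      TpTp k V ⊓ LinearMap.ker (LinearMap.mul' k (TensorAlgebra k V)) := by
  rintro _ ⟨_, ⟨y, rfl⟩, rfl⟩
  induction y using TensorProduct.induction_on with
  | zero => simp
  | add x y hx hy => simpa only [map_add] using Submodule.add_mem _ hx hy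
  | tmul a y =>
    induction y using TensorProduct.induction_on with
    | zero => simp
    | add x y hx hy => simpa only [map_add, tmul_add] using Submodule.add_mem _ hx hy
    | tmul t b =>
      simp only [TensorProduct.map_tmul, Submodule.subtype_apply, LinearMap.id_apply, theta_tmul]
      refine ⟨Submodule.sub_mem _ (tmul_mem_TpTp a.2 (mul_mem_Tplus_left t b.2))
        (tmul_mem_TpTp (mul_mem_Tplus_right a.2 t) b.2), ?_⟩
      simp [mul_assoc]

variable (k V)

/-- The action of `T(V)` on `T(V) ⊕ (T(V) ⊗ T(V))` in which `v : V` sends `(t, w)` to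
`(v t, v ⊗ t)`. -/
noncomputable def splitAction :
    TensorAlgebra k V →ₐ[k]
      Module.End k (TensorAlgebra k V × (TensorAlgebra k V ⊗[k] TensorAlgebra k V)) :=
  TensorAlgebra.lift k
    { toFun := fun v => LinearMap.prod
        (LinearMap.mulLeft k (TensorAlgebra.ι k v) ∘ₗ LinearMap.fst k _ _)
        (TensorProduct.mk k _ _ (TensorAlgebra.ι k v) ∘ₗ LinearMap.fst k _ _)
      map_add' := fun v w => by
        refine LinearMap.ext fun x => Prod.ext ?_ ?_ <;> simp [add_mul]
      map_smul' := fun c v => by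
        refine LinearMap.ext fun x => Prod.ext ?_ ?_ <;> simp [smul_tmul'] }

/-- The linear map `T(V) → T(V) ⊗ T(V)` that splits off the first letter,
`v t ↦ v ⊗ t`. -/
noncomputable def splitFirst :
    TensorAlgebra k V →ₗ[k] TensorAlgebra k V ⊗[k] TensorAlgebra k V :=
  LinearMap.snd k _ _ ∘ₗ LinearMap.applyₗ (1, 0) ∘ₗ (splitAction k V).toLinearMap

variable {k V}

theorem splitAction_ι_apply (v : V)
    (x : TensorAlgebra k V × (TensorAlgebra k V ⊗[k] TensorAlgebra k V)) :
    splitAction k V (TensorAlgebra.ι k v) x =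
      (TensorAlgebra.ι k v * x.1, TensorAlgebra.ι k v ⊗ₜ x.1) := by
  simp [splitAction]

theorem splitAction_apply_fst (a : TensorAlgebra k V)
    (x : TensorAlgebra k V × (TensorAlgebra k V ⊗[k] TensorAlgebra k V)) :
    (splitAction k V a x).1 = a * x.1 := by
  induction a using TensorAlgebra.induction generalizing x with
  | algebraMap r => simp [Algebra.smul_def]
  | ι v => rw [splitAction_ι_apply]
  | mul a b ha hb => rw [map_mul, Module.End.mul_apply, ha, hb, mul_assoc]
  | add a b ha hb => rw [map_add, LinearMap.add_apply, Prod.fst_add, ha, hb, add_mul]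

theorem splitFirst_ι_mul (v : V) (t : TensorAlgebra k V) :
    splitFirst k V (TensorAlgebra.ι k v * t) = TensorAlgebra.ι k v ⊗ₜ t := by
  simp [splitFirst, splitAction_ι_apply, splitAction_apply_fst]

theorem splitFirst_mul_sub_mem {x : TensorAlgebra k V ⊗[k] TensorAlgebra k V}
    (hx : x ∈ TpTp k V) :
    splitFirst k V (LinearMap.mul' k (TensorAlgebra k V) x) - x ∈
      Submodule.map (theta k V) (TpTTp k V) := by
  obtain ⟨y, rfl⟩ := hx
  induction y using TensorProduct.induction_on with
  | zero => simp
  | add x y hx hy =>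
    simpa only [map_add, add_sub_add_comm] using Submodule.add_mem _ hx hy
  | tmul a b =>
    obtain ⟨a, ha⟩ := a
    obtain ⟨b, hb⟩ := b
    simp only [TensorProduct.map_tmul, Submodule.subtype_apply, LinearMap.mul'_apply]
    rw [Tplus_eq_range_mul_top] at ha
    refine Submodule.mul_induction_on ha ?_ fun x y hx hy => ?_
    · rintro _ ⟨v, rfl⟩ t -
      rw [mul_assoc, splitFirst_ι_mul, ← theta_tmul]
      exact Submodule.mem_map_of_mem (tmul_mem_TpTTp (ι_mem_Tplus v) t hb)
    · simpa only [add_mul, add_tmul, map_add, add_sub_add_comm] using Submodule.add_mem _ hx hy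

end Auxiliary

/-- The multiplication map `T(V)⁺ ⊗ T(V)⁺ → T(V)_{(2)}` is surjective and its kernel is
the image of `id ⊗ m − m ⊗ id : T(V)⁺ ⊗ T(V) ⊗ T(V)⁺ → T(V)⁺ ⊗ T(V)⁺`. -/
theorem stmt_1 (k V : Type*) [Field k] [CharZero k] [AddCommGroup V] [Module k V] :
    Submodule.map (LinearMap.mul' k (TensorAlgebra k V)) (TpTp k V) = Ttwo k V ∧
    Submodule.map (theta k V) (TpTTp k V)
      = TpTp k V ⊓ LinearMap.ker (LinearMap.mul' k (TensorAlgebra k V)) := by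
  refine ⟨map_mul'_TpTp, le_antisymm map_theta_TpTTp_le fun x hx => ?_⟩
  have h := splitFirst_mul_sub_mem hx.1
  rw [LinearMap.mem_ker.1 hx.2, map_zero, zero_sub] at h
  exact (Submodule.neg_mem_iff _).1 h

end Rigidity
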